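/- arXiv:2010.01067 — 8 statements merged into one kernel-verified Lean document; each statement's English description precedes it below -/
import Mathlib

section
/- Let a and b be positive integers and let D : Matrix (Fin a) (Fin b) ℝ have nonnegative entries, with every row of D nonzero and every entry of Dᵀ * D strictly positive. Then there exists exactly one triple (d, α, β) consisting of a real number d > 0 and vectors α : Fin a → ℝ, β : Fin b → ℝ with strictly positive entries satisfying ∑ i, (α i)^2 = 1, ∑ j, (β j)^2 = 1, D.mulVec β = d • α, and D.transpose.mulVec α = d • β. -/
open Matrix

section PerronFrobenius

variable {n : Type*} [Fintype n]

/-- A matrix with positive entries maps nonzero nonnegative vectors to positive vectors. -/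
lemma mulVec_pos_of_entries_pos {M : Matrix n n ℝ} (hM : ∀ i j, 0 < M i j)
    {x : n → ℝ} (hx : ∀ i, 0 ≤ x i) (hx0 : x ≠ 0) (i : n) : 0 < (M *ᵥ x) i := by
  obtain ⟨k, hk⟩ := Function.ne_iff.mp hx0
  exact Finset.sum_pos' (fun j _ => mul_nonneg (hM i j).le (hx j))
    ⟨k, Finset.mem_univ k, mul_pos (hM i k) ((hx k).lt_of_ne' hk)⟩

/-- A positive vector dominates a largest positive multiple of any other positive vector. -/
lemma exists_pos_smul_le [Nonempty n] {y z : n → ℝ} (hy : ∀ i, 0 < y i) (hz : ∀ i, 0 < z i) :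
    ∃ c : ℝ, 0 < c ∧ (∀ i, c * y i ≤ z i) ∧ ∃ i, c * y i = z i := by
  obtain ⟨k, hk⟩ := Finite.exists_min (fun i => z i / y i)
  refine ⟨z k / y k, div_pos (hz k) (hy k), fun i => ?_, k, div_mul_cancel₀ _ (hy k).ne'⟩
  exact (le_div_iff₀ (hy i)).mp (hk i)

/-- Perron's theorem: a matrix with positive entries has a positive eigenvector with positive
eigenvalue. -/
lemma exists_pos_eigenvector [Nonempty n] {M : Matrix n n ℝ} (hM : ∀ i j, 0 < M i j) :
    ∃ (r : ℝ) (x : n → ℝ), 0 < r ∧ (∀ i, 0 < x i) ∧ M *ᵥ x = r • x := by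
  classical
  set B : ℝ := ∑ i, ∑ j, M i j
  have hMx (x : n → ℝ) (hx : x ∈ stdSimplex ℝ n) : ∑ i, (M *ᵥ x) i ≤ B := by
    refine Finset.sum_le_sum fun i _ => Finset.sum_le_sum fun j _ => ?_
    have : x j ≤ 1 := by
      rw [← hx.2]
      exact Finset.single_le_sum (fun k _ => hx.1 k) (Finset.mem_univ j)
    exact mul_le_of_le_one_right (hM i j).le this
  set K : Set (ℝ × (n → ℝ)) :=
    (Set.Icc 0 B ×ˢ stdSimplex ℝ n) ∩ {p | ∀ i, p.1 * p.2 i ≤ (M *ᵥ p.2) i}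
  have mem_K {r : ℝ} {x : n → ℝ} (hr : 0 ≤ r) (hx : x ∈ stdSimplex ℝ n)
      (h : ∀ i, r * x i ≤ (M *ᵥ x) i) : (r, x) ∈ K := by
    refine ⟨⟨⟨hr, ?_⟩, hx⟩, h⟩
    calc r = ∑ i, r * x i := by rw [← Finset.mul_sum, hx.2, mul_one]
      _ ≤ ∑ i, (M *ᵥ x) i := Finset.sum_le_sum fun i _ => h i
      _ ≤ B := hMx x hx
  have hKc : IsCompact K := by
    refine (isCompact_Icc.prod (isCompact_stdSimplex ℝ n)).inter_right ?_
    simp only [Set.ofPred_forall]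
    refine isClosed_iInter fun i => isClosed_le (by fun_prop) ?_
    simp only [mulVec, dotProduct]
    fun_prop
  have hKne : K.Nonempty := by
    obtain ⟨k⟩ := ‹Nonempty n›
    refine ⟨(0, Pi.single k 1), mem_K le_rfl (single_mem_stdSimplex ℝ k) fun i => ?_⟩
    simpa using (hM i k).le
  obtain ⟨⟨r, x⟩, ⟨⟨⟨hr, -⟩, hx⟩, hle⟩, hmax⟩ :=
    hKc.exists_isMaxOn hKne continuous_fst.continuousOn
  dsimp only at hr hx hle
  have hx0 : x ≠ 0 := by
    rintro rfl
    simpa using hx.2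
  have hpos := mulVec_pos_of_entries_pos hM hx.1 hx0
  have heig : M *ᵥ x = r • x := by
    by_contra hne
    have hgap : ∀ i, 0 < (M *ᵥ (M *ᵥ x - r • x)) i :=
      mulVec_pos_of_entries_pos hM (fun i => by simpa using hle i) (sub_ne_zero.mpr hne)
    obtain ⟨c, hc, hcle, -⟩ := exists_pos_smul_le hpos hgap
    set s : ℝ := ∑ i, (M *ᵥ x) i
    have hs : 0 < s := Finset.sum_pos (fun i _ => hpos i) Finset.univ_nonempty
    have hy : s⁻¹ • (M *ᵥ x) ∈ stdSimplex ℝ n := by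
      refine ⟨fun i => mul_nonneg (inv_pos.mpr hs).le (hpos i).le, ?_⟩
      simp only [Pi.smul_apply, smul_eq_mul, ← Finset.mul_sum]
      exact inv_mul_cancel₀ hs.ne'
    have hmem : (r + c, s⁻¹ • (M *ᵥ x)) ∈ K := by
      refine mem_K (by positivity) hy fun i => ?_
      have h := hcle i
      simp only [mulVec_sub, mulVec_smul, Pi.sub_apply, Pi.smul_apply, smul_eq_mul] at h ⊢
      calc (r + c) * (s⁻¹ * (M *ᵥ x) i) = s⁻¹ * ((r + c) * (M *ᵥ x) i) := by ring
        _ ≤ s⁻¹ * (M *ᵥ (M *ᵥ x)) i :=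
          mul_le_mul_of_nonneg_left (by linarith) (inv_pos.mpr hs).le
    have : r + c ≤ r := hmax hmem
    linarith
  have hrx (i : n) : 0 < r * x i := by
    simpa [heig] using hpos i
  obtain ⟨k⟩ := ‹Nonempty n›
  exact ⟨r, x, pos_of_mul_pos_left (hrx k) (hx.1 k),
    fun i => pos_of_mul_pos_right (hrx i) hr, heig⟩

/-- Positive `ℓ²`-normalized eigenvectors of a matrix with positive entries for the same
eigenvalue coincide. -/
lemma pos_eigenvector_unique [Nonempty n] {M : Matrix n n ℝ} (hM : ∀ i j, 0 < M i j) {r : ℝ}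
    {x y : n → ℝ} (hx : ∀ i, 0 < x i) (hy : ∀ i, 0 < y i)
    (hx1 : ∑ i, x i ^ 2 = 1) (hy1 : ∑ i, y i ^ 2 = 1)
    (hMx : M *ᵥ x = r • x) (hMy : M *ᵥ y = r • y) : x = y := by
  obtain ⟨c, hc, hle, k, hk⟩ := exists_pos_smul_le hy hx
  have hxy : x = c • y := by
    by_contra hne
    have h := mulVec_pos_of_entries_pos hM (x := x - c • y) (fun i => by simpa using hle i)
      (sub_ne_zero.mpr hne) k
    simp only [mulVec_sub, mulVec_smul, hMx, hMy, Pi.sub_apply, Pi.smul_apply, smul_eq_mul,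
      ← hk] at h
    exact absurd h (by ring_nf; exact lt_irrefl 0)
  have hc1 : c ^ 2 = 1 := by
    simpa [hxy, mul_pow, ← Finset.mul_sum, hy1] using hx1
  have : c = 1 := by nlinarith
  simpa [this] using hxy

/-- Positive eigenvectors of a symmetric matrix share their eigenvalue. -/
lemma pos_eigenvalue_unique [Nonempty n] {M : Matrix n n ℝ} (hM : Mᵀ = M) {r s : ℝ}
    {x y : n → ℝ} (hx : ∀ i, 0 < x i) (hy : ∀ i, 0 < y i)
    (hMx : M *ᵥ x = r • x) (hMy : M *ᵥ y = s • y) : r = s := by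
  have hxy : 0 < x ⬝ᵥ y :=
    Finset.sum_pos (fun i _ => mul_pos (hx i) (hy i)) Finset.univ_nonempty
  have h : (M *ᵥ x) ⬝ᵥ y = x ⬝ᵥ (M *ᵥ y) := by
    rw [dotProduct_mulVec, ← mulVec_transpose, hM]
  rw [hMx, hMy, smul_dotProduct, dotProduct_smul, smul_eq_mul, smul_eq_mul] at h
  exact mul_right_cancel₀ hxy.ne' h

end PerronFrobenius

/-- Frobenius–Perron normalization: unique positive triple `(d, α, β)` with
`Dβ = dα`, `Dᵀα = dβ` and `‖α‖₂ = ‖β‖₂ = 1`. -/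
theorem stmt_0 (a b : ℕ) (ha : 0 < a) (hb : 0 < b)
    (D : Matrix (Fin a) (Fin b) ℝ)
    (hD : ∀ i j, 0 ≤ D i j)
    (hrow : ∀ i, D i ≠ 0)
    (hDTD : ∀ j j', 0 < (Dᵀ * D) j j') :
    ∃! t : ℝ × (Fin a → ℝ) × (Fin b → ℝ),
      0 < t.1 ∧ (∀ i, 0 < t.2.1 i) ∧ (∀ j, 0 < t.2.2 j) ∧
      (∑ i, (t.2.1 i) ^ 2 = 1) ∧ (∑ j, (t.2.2 j) ^ 2 = 1) ∧
      D.mulVec t.2.2 = t.1 • t.2.1 ∧ Dᵀ.mulVec t.2.1 = t.1 • t.2.2 := by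
  have : Nonempty (Fin b) := ⟨⟨0, hb⟩⟩
  have hsymm : (Dᵀ * D)ᵀ = Dᵀ * D := by simp
  refine existsUnique_of_exists_of_unique ?_ ?_
  · obtain ⟨r, x, hr, hx, hMx⟩ := exists_pos_eigenvector hDTD
    set N : ℝ := ∑ j, x j ^ 2
    have hN : 0 < N := Finset.sum_pos (fun j _ => pow_pos (hx j) 2) Finset.univ_nonempty
    set β : Fin b → ℝ := (√N)⁻¹ • x with hβdef
    have hβ (j : Fin b) : 0 < β j := mul_pos (inv_pos.mpr (Real.sqrt_pos.mpr hN)) (hx j)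
    have hβ1 : ∑ j, β j ^ 2 = 1 := by
      simp only [hβdef, Pi.smul_apply, smul_eq_mul, mul_pow, ← Finset.mul_sum, inv_pow,
        Real.sq_sqrt hN.le]
      exact inv_mul_cancel₀ hN.ne'
    have hMβ : Dᵀ *ᵥ (D *ᵥ β) = r • β := by
      rw [mulVec_mulVec, hβdef, mulVec_smul, hMx, smul_comm]
    have hd : 0 < √r := Real.sqrt_pos.mpr hr
    have hDβ (i : Fin a) : 0 < (D *ᵥ β) i := by
      obtain ⟨k, hk⟩ := Function.ne_iff.mp (hrow i)
      exact Finset.sum_pos' (fun j _ => mul_nonneg (hD i j) (hβ j).le)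
        ⟨k, Finset.mem_univ k, mul_pos ((hD i k).lt_of_ne' hk) (hβ k)⟩
    have hnorm : ∑ i, (D *ᵥ β) i ^ 2 = r := by
      calc ∑ i, (D *ᵥ β) i ^ 2 = (D *ᵥ β) ⬝ᵥ (D *ᵥ β) := by simp only [dotProduct, sq]
        _ = (Dᵀ *ᵥ (D *ᵥ β)) ⬝ᵥ β := by rw [dotProduct_mulVec, mulVec_transpose]
        _ = r * ∑ j, β j ^ 2 := by
          rw [hMβ, smul_dotProduct, smul_eq_mul]
          simp only [dotProduct, sq]
        _ = r := by rw [hβ1, mul_one]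
    refine ⟨(√r, (√r)⁻¹ • (D *ᵥ β), β), hd, fun i => mul_pos (inv_pos.mpr hd) (hDβ i), hβ, ?_,
      hβ1, (smul_inv_smul₀ hd.ne' _).symm, ?_⟩
    · simp only [Pi.smul_apply, smul_eq_mul, mul_pow, ← Finset.mul_sum, inv_pow,
        Real.sq_sqrt hr.le, hnorm]
      exact inv_mul_cancel₀ hr.ne'
    · change Dᵀ *ᵥ ((√r)⁻¹ • (D *ᵥ β)) = √r • β
      rw [mulVec_smul, hMβ, inv_smul_eq_iff₀ hd.ne', smul_smul (√r) (√r) β,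
        Real.mul_self_sqrt hr.le]
  · rintro ⟨d, α, β⟩ ⟨d', α', β'⟩ ⟨hd, -, hβ, -, hβ1, h1, h2⟩ ⟨hd', -, hβ', -, hβ1', h1', h2'⟩
    dsimp only at *
    have hM : (Dᵀ * D) *ᵥ β = (d * d) • β := by
      rw [← mulVec_mulVec, h1, mulVec_smul, h2, smul_smul]
    have hM' : (Dᵀ * D) *ᵥ β' = (d' * d') • β' := by
      rw [← mulVec_mulVec, h1', mulVec_smul, h2', smul_smul]
    obtain rfl : d = d' :=
      (mul_self_inj hd.le hd'.le).mp (pos_eigenvalue_unique hsymm hβ hβ' hM hM')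
    obtain rfl : β = β' := pos_eigenvector_unique hDTD hβ hβ' hβ1 hβ1' hM hM'
    obtain rfl : α = α' := smul_right_injective _ hd.ne' (h1.symm.trans h1')
    rfl
end

section
/- Let a and b be positive integers. The map sending a pair (η, ξ), where η : Fin a → ℝ and ξ : Fin b → ℝ have strictly positive entries and η 0 = 1, to the matrix (i, j) ↦ ξ j / η i, is a bijection onto the set of matrices δ : Fin a → Fin b → ℝ with strictly positive entries satisfying the cross-ratio condition δ i j * δ i' j' = δ i j' * δ i' j for all i, i', j, j'. -/
/-- Parametrization of cross-ratio matrices: the map `(η, ξ) ↦ (i, j) ↦ ξ j / η i`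
is a bijection from pairs of strictly positive vectors normalized so that
`η 0 = 1` onto the strictly positive matrices satisfying the cross-ratio
condition `δ i j * δ i' j' = δ i j' * δ i' j`. -/
theorem stmt_6 (a b : ℕ) (ha : 0 < a) (hb : 0 < b) :
    Set.BijOn
      (fun p : (Fin a → ℝ) × (Fin b → ℝ) => fun i j => p.2 j / p.1 i)
      {p : (Fin a → ℝ) × (Fin b → ℝ) |
        (∀ i, 0 < p.1 i) ∧ (∀ j, 0 < p.2 j) ∧ p.1 ⟨0, ha⟩ = 1}
      {δ : Fin a → Fin b → ℝ |
        (∀ i j, 0 < δ i j) ∧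
        ∀ i i' j j', δ i j * δ i' j' = δ i j' * δ i' j} := by
  refine ⟨?_, ?_, ?_⟩
  · rintro ⟨η, ξ⟩ ⟨hη, hξ, -⟩
    refine ⟨fun i j => div_pos (hξ j) (hη i), fun i i' j j' => ?_⟩
    simp only [div_mul_div_comm, mul_comm (ξ j)]
  · rintro ⟨η, ξ⟩ ⟨hη, hξ, h1⟩ ⟨η', ξ'⟩ ⟨-, -, h1'⟩ h
    have hq : ∀ i j, ξ j / η i = ξ' j / η' i := fun i j => congrFun (congrFun h i) j
    have hξξ' : ξ = ξ' := by
      funext j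
      have := hq ⟨0, ha⟩ j
      simp only at h1 h1'
      rwa [h1, h1', div_one, div_one] at this
    subst hξξ'
    have hηη' : η = η' := by
      funext i
      exact inv_injective (mul_left_cancel₀ (hξ ⟨0, hb⟩).ne' (hq i ⟨0, hb⟩))
    rw [hηη']
  · rintro δ ⟨hpos, hcross⟩
    refine ⟨(fun i => δ ⟨0, ha⟩ ⟨0, hb⟩ / δ i ⟨0, hb⟩, fun j => δ ⟨0, ha⟩ j),
      ⟨fun i => div_pos (hpos _ _) (hpos _ _), fun j => hpos _ _,
        div_self (hpos _ _).ne'⟩, ?_⟩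
    funext i j
    have h := hcross ⟨0, ha⟩ i j ⟨0, hb⟩
    simp only
    rw [div_div_eq_mul_div, h, mul_div_cancel_left₀ _ (hpos _ _).ne']
end

section
/- Let a and b be positive integers and let D : Matrix (Fin a) (Fin b) ℝ have nonnegative entries, with every row of D nonzero and every entry of Dᵀ * D strictly positive. Let d > 0 and α : Fin a → ℝ, β : Fin b → ℝ have strictly positive entries with D.mulVec β = d • α and Dᵀ.mulVec α = d • β. Let η : Fin a → ℝ and ξ : Fin b → ℝ have strictly positive entries. Then the following are equivalent: (1) for all i and j, (Matrix.vecMul (Matrix.vecMul ξ Dᵀ) D) j / (Matrix.vecMul ξ Dᵀ) i = ξ j / η i; (2) for all i and j, ξ j / η i = d * β j / α i. -/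
open Matrix

/-- An entrywise positive matrix has, up to scaling, at most one eigenvector for an eigenvalue
admitting a positive eigenvector. -/
theorem Matrix.eq_smul_of_mulVec_eq_smul_of_pos {n : Type*} [Fintype n] [Nonempty n]
    {M : Matrix n n ℝ} (hM : ∀ i j, 0 < M i j) {c : ℝ} {v w : n → ℝ} (hv : ∀ i, 0 < v i)
    (hMv : M *ᵥ v = c • v) (hMw : M *ᵥ w = c • w) : ∃ t : ℝ, w = t • v := by
  obtain ⟨k, hk⟩ := Finite.exists_min fun i => w i / v i
  refine ⟨w k / v k, ?_⟩
  have hk0 : (w - (w k / v k) • v) k = 0 := by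
    simp [div_mul_cancel₀ _ (hv k).ne']
  have hnonneg : ∀ i, 0 ≤ (w - (w k / v k) • v) i := fun i => by
    simpa using (le_div_iff₀ (hv i)).1 (hk i)
  have hsum : (M *ᵥ (w - (w k / v k) • v)) k = 0 := by
    have h : M *ᵥ (w - (w k / v k) • v) = c • (w - (w k / v k) • v) := by
      rw [mulVec_sub, mulVec_smul, hMv, hMw, smul_sub, smul_comm]
    rw [h, Pi.smul_apply, hk0, smul_zero]
  have hzero := (Finset.sum_eq_zero_iff_of_nonneg
    fun i _ => mul_nonneg (hM k i).le (hnonneg i)).1 hsum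
  refine sub_eq_zero.1 (funext fun i => ?_)
  exact (mul_eq_zero.1 (hzero i (Finset.mem_univ i))).resolve_left (hM k i).ne'

/-- Positive eigenvectors of a symmetric matrix have the same eigenvalue. -/
theorem Matrix.IsSymm.eigenvalue_eq_of_pos {n : Type*} [Fintype n] [Nonempty n]
    {M : Matrix n n ℝ} (hM : M.IsSymm) {c d : ℝ} {v w : n → ℝ} (hv : ∀ i, 0 < v i)
    (hw : ∀ i, 0 < w i) (hMv : M *ᵥ v = c • v) (hMw : M *ᵥ w = d • w) : c = d := by
  have hpos : 0 < v ⬝ᵥ w :=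
    Finset.sum_pos (fun i _ => mul_pos (hv i) (hw i)) Finset.univ_nonempty
  have h : v ⬝ᵥ (M *ᵥ w) = (M *ᵥ v) ⬝ᵥ w := by
    rw [dotProduct_mulVec, ← mulVec_transpose, hM.eq]
  rw [hMv, hMw, dotProduct_smul, smul_dotProduct, smul_eq_mul, smul_eq_mul] at h
  exact (mul_right_cancel₀ hpos.ne' h).symm

/-- Theorem 4.5 (fixed point): a cross-ratio matrix `δ i j = ξ j / η i` is a
fixed point of the distortion dynamical system iff it equals the standard
distortion `σ i j = d * β j / α i`. -/
theorem stmt_7 (a b : ℕ) (ha : 0 < a) (hb : 0 < b)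
    (D : Matrix (Fin a) (Fin b) ℝ)
    (hD : ∀ i j, 0 ≤ D i j)
    (hrow : ∀ i, D i ≠ 0)
    (hDTD : ∀ j j', 0 < (Dᵀ * D) j j')
    (d : ℝ) (hd : 0 < d)
    (α : Fin a → ℝ) (β : Fin b → ℝ)
    (hα : ∀ i, 0 < α i) (hβ : ∀ j, 0 < β j)
    (h1 : D.mulVec β = d • α) (h2 : Dᵀ.mulVec α = d • β)
    (η : Fin a → ℝ) (ξ : Fin b → ℝ)
    (hη : ∀ i, 0 < η i) (hξ : ∀ j, 0 < ξ j) :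
    (∀ i j, (Matrix.vecMul (Matrix.vecMul ξ Dᵀ) D) j / (Matrix.vecMul ξ Dᵀ) i
        = ξ j / η i) ↔
    (∀ i j, ξ j / η i = d * β j / α i) := by
  have : Nonempty (Fin a) := ⟨⟨0, ha⟩⟩
  have : Nonempty (Fin b) := ⟨⟨0, hb⟩⟩
  let i₀ : Fin a := ⟨0, ha⟩
  let j₀ : Fin b := ⟨0, hb⟩
  rw [vecMul_transpose, ← mulVec_transpose]
  constructor
  · intro h
    have hu : ∀ i, (D *ᵥ ξ) i ≠ 0 := fun i hi => by
      have hpos := div_pos (hξ j₀) (hη i)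
      rw [← h i j₀, hi, div_zero] at hpos
      exact hpos.false
    have hcross : ∀ i j, (Dᵀ *ᵥ (D *ᵥ ξ)) j * η i = ξ j * (D *ᵥ ξ) i := fun i j =>
      (div_eq_div_iff (hu i) (hη i).ne').1 (h i j)
    have hMξ : (Dᵀ * D) *ᵥ ξ = ((D *ᵥ ξ) i₀ / η i₀) • ξ := by
      rw [← mulVec_mulVec]
      ext j
      have := hcross i₀ j
      have := (hη i₀).ne'
      simp only [Pi.smul_apply, smul_eq_mul]
      field_simp
      linarith
    have hMβ : (Dᵀ * D) *ᵥ β = (d * d) • β := by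
      rw [← mulVec_mulVec, h1, mulVec_smul, h2, smul_smul]
    have hsymm : (Dᵀ * D).IsSymm := by
      rw [IsSymm, transpose_mul, transpose_transpose]
    have hc := hsymm.eigenvalue_eq_of_pos hξ hβ hMξ hMβ
    rw [hc] at hMξ
    obtain ⟨t, rfl⟩ := eq_smul_of_mulVec_eq_smul_of_pos hDTD hβ hMβ hMξ
    intro i j
    rw [← h i j, mulVec_mulVec, hMξ, mulVec_smul, h1]
    have ht : t ≠ 0 := fun ht => (hξ j₀).ne' (by simp [ht])
    have := (hα i).ne'
    simp only [Pi.smul_apply, smul_eq_mul]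
    field_simp
  · intro h
    have hξβ : ξ = (d * η i₀ / α i₀) • β := by
      ext j
      have := h i₀ j
      have := (hη i₀).ne'
      have := (hα i₀).ne'
      simp only [Pi.smul_apply, smul_eq_mul]
      field_simp at *
      linarith
    intro i j
    have hu : D *ᵥ ξ = (d * η i₀ / α i₀ * d) • α := by
      rw [hξβ, mulVec_smul, h1, smul_smul]
    rw [h i j, hu, mulVec_smul, h2]
    have := (hη i₀).ne'
    have := (hα i₀).ne'
    have := (hα i).ne'
    simp only [Pi.smul_apply, smul_eq_mul]
    field_simp
end

section
/- Let a and b be positive integers and let D : Matrix (Fin a) (Fin b) ℝ have nonnegative entries, with every row of D nonzero and every entry of Dᵀ * D strictly positive. Let d > 0 and α : Fin a → ℝ, β : Fin b → ℝ have strictly positive entries with D.mulVec β = d • α and Dᵀ.mulVec α = d • β. Then for every ξ : Fin b → ℝ with strictly positive entries and all i : Fin a, j : Fin b, the sequence n ↦ (Matrix.vecMul ξ ((Dᵀ * D) ^ (n + 1))) j / (Matrix.vecMul (Matrix.vecMul ξ ((Dᵀ * D) ^ n)) Dᵀ) i converges (as n → ∞) to d * β j / α i. -/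
open Matrix Filter

section PositiveSymmetric

variable {ι : Type*} [Fintype ι]

/-- A vector dominated by a positive eigenvector `β` and orthogonal to it is mapped by `M` to a
vector dominated with the smaller constant `C * μ`, once a multiple of `β βᵀ` lies below `M`. -/
theorem abs_vecMul_le_of_orthogonal {M : Matrix ι ι ℝ} {β w : ι → ℝ} {lam ε C : ℝ}
    (hM : ∀ k j, ε * β k * β j ≤ M k j) (hβM : β ᵥ* M = lam • β)
    (hw : w ⬝ᵥ β = 0) (hC : ∀ k, |w k| ≤ C * β k) (j : ι) :
    |(w ᵥ* M) j| ≤ C * (lam - ε * (β ⬝ᵥ β)) * β j := by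
  have hsub (v : ι → ℝ) :
      ∑ k, v k * (M k j - ε * β k * β j) = (v ᵥ* M) j - ε * (v ⬝ᵥ β) * β j := by
    simp only [vecMul, dotProduct, Finset.mul_sum, Finset.sum_mul, ← Finset.sum_sub_distrib]
    exact Finset.sum_congr rfl fun k _ => by ring
  calc |(w ᵥ* M) j| = |∑ k, w k * (M k j - ε * β k * β j)| := by simp [hsub, hw]
    _ ≤ ∑ k, |w k * (M k j - ε * β k * β j)| := Finset.abs_sum_le_sum_abs _ _
    _ ≤ ∑ k, C * (β k * (M k j - ε * β k * β j)) := by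
        refine Finset.sum_le_sum fun k _ => ?_
        have h := sub_nonneg.2 (hM k j)
        rw [abs_mul, abs_of_nonneg h, ← mul_assoc]
        exact mul_le_mul_of_nonneg_right (hC k) h
    _ = C * (lam - ε * (β ⬝ᵥ β)) * β j := by
        rw [← Finset.mul_sum, hsub, hβM, Pi.smul_apply, smul_eq_mul]
        ring

/-- There is a positive multiple of `β βᵀ` below any matrix with positive entries. -/
theorem exists_pos_mul_mul_le {M : Matrix ι ι ℝ} (hM : ∀ k j, 0 < M k j) (β : ι → ℝ) :
    ∃ ε > 0, ∀ k j, ε * β k * β j ≤ M k j := by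
  have h : ∀ᶠ ε : ℝ in nhdsWithin 0 (Set.Ioi 0), ∀ k j, ε * β k * β j ≤ M k j := by
    refine eventually_all.2 fun k => eventually_all.2 fun j => nhdsWithin_le_nhds ?_
    have hc : Continuous fun ε : ℝ => ε * β k * β j := by fun_prop
    exact (hc.tendsto' 0 0 (by simp)).eventually_le_const (hM k j)
  obtain ⟨ε, hε, hpos⟩ := (h.and self_mem_nhdsWithin).exists
  exact ⟨ε, hpos, hε⟩

/-- Perron convergence for a symmetric matrix with positive entries and a positive eigenvector
`β`: the normalised iterates of `ξ` converge to the orthogonal projection of `ξ` to `ℝ β`. -/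
theorem tendsto_vecMul_pow_div [DecidableEq ι] {M : Matrix ι ι ℝ} (hsymm : M.IsSymm)
    (hM : ∀ k j, 0 < M k j) {β : ι → ℝ} (hβ : ∀ k, 0 < β k) {lam : ℝ} (hlam : 0 < lam)
    (hMβ : M *ᵥ β = lam • β) (ξ : ι → ℝ) (j : ι) :
    Tendsto (fun n : ℕ => (ξ ᵥ* M ^ n) j / lam ^ n) atTop
      (nhds ((ξ ⬝ᵥ β) / (β ⬝ᵥ β) * β j)) := by
  have hβM : β ᵥ* M = lam • β := by rw [← mulVec_transpose, hsymm.eq, hMβ]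
  have hββ : 0 < β ⬝ᵥ β :=
    Finset.sum_pos (fun k _ => mul_pos (hβ k) (hβ k)) ⟨j, Finset.mem_univ j⟩
  obtain ⟨ε, hε, hεM⟩ := exists_pos_mul_mul_le hM β
  set c := (ξ ⬝ᵥ β) / (β ⬝ᵥ β) with hc
  set μ := lam - ε * (β ⬝ᵥ β) with hμ
  have hμlam : μ < lam := sub_lt_self _ (mul_pos hε hββ)
  have hμ0 : 0 ≤ μ := by
    have h := abs_vecMul_le_of_orthogonal (w := 0) (C := 1) hεM hβM (by simp)
      (fun k => by simpa using (hβ k).le) j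
    rw [one_mul, ← hμ] at h
    exact nonneg_of_mul_nonneg_left ((abs_nonneg _).trans h) (hβ j)
  have hβpow (n : ℕ) : β ᵥ* M ^ n = lam ^ n • β := by
    induction n with
    | zero => simp
    | succ n ih => rw [pow_succ, ← vecMul_vecMul, ih, smul_vecMul, hβM, smul_smul, pow_succ]
  set w := ξ - c • β with hw
  have hwβ : w ⬝ᵥ β = 0 := by
    rw [hw, sub_dotProduct, smul_dotProduct, smul_eq_mul, hc, div_mul_cancel₀ _ hββ.ne', sub_self]
  have horth (n : ℕ) : (w ᵥ* M ^ n) ⬝ᵥ β = 0 := by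
    induction n with
    | zero => simpa using hwβ
    | succ n ih =>
      rw [pow_succ, ← vecMul_vecMul, ← dotProduct_mulVec, hMβ, dotProduct_smul, ih, smul_zero]
  obtain ⟨C, hC⟩ : ∃ C, ∀ k, |w k| ≤ C * β k := by
    refine ⟨∑ k, |w k| / β k, fun k => ?_⟩
    rw [← div_le_iff₀ (hβ k)]
    exact Finset.single_le_sum (f := fun k => |w k| / β k)
      (fun k _ => div_nonneg (abs_nonneg _) (hβ k).le) (Finset.mem_univ k)
  have hbound (n : ℕ) : ∀ k, |(w ᵥ* M ^ n) k| ≤ C * μ ^ n * β k := by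
    induction n with
    | zero => simpa using hC
    | succ n ih =>
      intro k
      rw [pow_succ, ← vecMul_vecMul, pow_succ, ← mul_assoc]
      exact abs_vecMul_le_of_orthogonal hεM hβM (horth n) ih k
  have hsplit (n : ℕ) : (ξ ᵥ* M ^ n) j / lam ^ n = (w ᵥ* M ^ n) j / lam ^ n + c * β j := by
    rw [hw, sub_vecMul, smul_vecMul, hβpow]
    simp only [Pi.sub_apply, Pi.smul_apply, smul_eq_mul]
    field_simp
    ring
  have hzero : Tendsto (fun n : ℕ => (w ᵥ* M ^ n) j / lam ^ n) atTop (nhds 0) := by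
    have hgeom : Tendsto (fun n : ℕ => C * β j * (μ / lam) ^ n) atTop (nhds 0) := by
      simpa using (tendsto_pow_atTop_nhds_zero_of_lt_one (div_nonneg hμ0 hlam.le)
        ((div_lt_one hlam).2 hμlam)).const_mul (C * β j)
    refine squeeze_zero_norm (fun n => ?_) hgeom
    rw [Real.norm_eq_abs, abs_div, abs_of_pos (pow_pos hlam n), div_pow, ← mul_div_assoc]
    gcongr
    exact (hbound n j).trans_eq (by ring)
  simpa [hsplit] using hzero.add_const (c * β j)

end PositiveSymmetric

/-- Theorem 4.5 (convergence): iterating the distortion dynamical system from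
any starting point converges to the standard distortion `σ i j = d * β j / α i`. -/
theorem stmt_8 (a b : ℕ) (ha : 0 < a) (hb : 0 < b)
    (D : Matrix (Fin a) (Fin b) ℝ)
    (hD : ∀ i j, 0 ≤ D i j)
    (hrow : ∀ i, D i ≠ 0)
    (hDTD : ∀ j j', 0 < (Dᵀ * D) j j')
    (d : ℝ) (hd : 0 < d)
    (α : Fin a → ℝ) (β : Fin b → ℝ)
    (hα : ∀ i, 0 < α i) (hβ : ∀ j, 0 < β j)
    (h1 : D.mulVec β = d • α) (h2 : Dᵀ.mulVec α = d • β)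
    (ξ : Fin b → ℝ) (hξ : ∀ j, 0 < ξ j) (i : Fin a) (j : Fin b) :
    Tendsto
      (fun n : ℕ =>
        (Matrix.vecMul ξ ((Dᵀ * D) ^ (n + 1))) j /
          (Matrix.vecMul (Matrix.vecMul ξ ((Dᵀ * D) ^ n)) Dᵀ) i)
      atTop (nhds (d * β j / α i)) := by
  have hd2 : 0 < d * d := mul_pos hd hd
  have hMβ : (Dᵀ * D) *ᵥ β = (d * d) • β := by
    rw [← mulVec_mulVec, h1, mulVec_smul, h2, smul_smul]
  have hconv := tendsto_vecMul_pow_div (M := Dᵀ * D) (by simp [IsSymm, transpose_mul]) hDTD hβ hd2 hMβ ξ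
  set c := (ξ ⬝ᵥ β) / (β ⬝ᵥ β)
  have hcpos : 0 < c := div_pos
    (Finset.sum_pos (fun k _ => mul_pos (hξ k) (hβ k)) ⟨j, Finset.mem_univ j⟩)
    (Finset.sum_pos (fun k _ => mul_pos (hβ k) (hβ k)) ⟨j, Finset.mem_univ j⟩)
  have hnum : Tendsto (fun n : ℕ => (ξ ᵥ* (Dᵀ * D) ^ (n + 1)) j / (d * d) ^ n) atTop
      (nhds (c * β j * (d * d))) := by
    refine (((tendsto_add_atTop_iff_nat 1).2 (hconv j)).mul_const (d * d)).congr fun n => ?_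
    field_simp
    ring
  have hden : Tendsto (fun n : ℕ => ((ξ ᵥ* (Dᵀ * D) ^ n) ᵥ* Dᵀ) i / (d * d) ^ n) atTop
      (nhds (c * (d * α i))) := by
    have hlim : ∑ k, c * β k * D i k = c * (d * α i) := by
      have h := congrFun h1 i
      simp only [mulVec, dotProduct, Pi.smul_apply, smul_eq_mul] at h
      rw [← h, Finset.mul_sum]
      exact Finset.sum_congr rfl fun k _ => by ring
    rw [← hlim]
    refine (tendsto_finsetSum _ fun k _ => (hconv k).mul_const (D i k)).congr fun n => ?_
    simp only [vecMul_transpose, mulVec, dotProduct, Finset.sum_div]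
    exact Finset.sum_congr rfl fun k _ => by ring
  have hαi := hα i
  have hdiv := hnum.div hden (by positivity)
  have hval : c * β j * (d * d) / (c * (d * α i)) = d * β j / α i := by
    field_simp
  rw [hval] at hdiv
  refine hdiv.congr fun n => ?_
  exact div_div_div_cancel_right₀ (pow_pos hd2 n).ne' _ _
end

section
/- Let b be a positive integer and let M : Matrix (Fin b) (Fin b) ℝ have all entries strictly positive. Let d > 0 and let β : Fin b → ℝ have strictly positive entries with Matrix.vecMul β M = d^2 • β. Then for every ξ : Fin b → ℝ with strictly positive entries there exists a real c > 0 such that for each j, the sequence n ↦ d^(-(2*n)) * (Matrix.vecMul ξ (M ^ n)) j converges (as n → ∞) to c * β j. -/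
open Matrix Filter

/-- Averaging with a positive column-stochastic matrix contracts the oscillation of a vector. -/
theorem vecMul_mem_Icc_of_colStochastic {ι : Type*} [Fintype ι] (Q : Matrix ι ι ℝ) {δ : ℝ}
    (hδ : ∀ i j, δ ≤ Q i j) (hQ : ∀ j, ∑ i, Q i j = 1) (y : ι → ℝ) {m K : ℝ}
    (hm : ∀ i, m ≤ y i) (hK : ∀ i, y i ≤ K) (j : ι) :
    (y ᵥ* Q) j ∈ Set.Icc (m + δ * ∑ i, (y i - m)) (K - δ * ∑ i, (K - y i)) := by
  have lower : δ * ∑ i, (y i - m) ≤ ∑ i, (y i - m) * Q i j := by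
    rw [Finset.mul_sum]
    exact Finset.sum_le_sum fun i _ => by nlinarith [hδ i j, hm i]
  have upper : δ * ∑ i, (K - y i) ≤ ∑ i, (K - y i) * Q i j := by
    rw [Finset.mul_sum]
    exact Finset.sum_le_sum fun i _ => by nlinarith [hδ i j, hK i]
  simp only [sub_mul, Finset.sum_sub_distrib, ← Finset.mul_sum, hQ, mul_one] at lower upper
  simp only [Matrix.vecMul, dotProduct, Finset.sum_sub_distrib, Set.mem_Icc]
  constructor <;> linarith

/-- The iterates of a positive vector under a positive column-stochastic matrix converge to a
positive constant vector. -/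
theorem exists_tendsto_vecMul_pow_of_colStochastic {ι : Type*} [Fintype ι] [DecidableEq ι]
    [Nonempty ι] (Q : Matrix ι ι ℝ) (hpos : ∀ i j, 0 < Q i j) (hQ : ∀ j, ∑ i, Q i j = 1)
    (x : ι → ℝ) (hx : ∀ i, 0 < x i) :
    ∃ c : ℝ, 0 < c ∧ ∀ j, Tendsto (fun n : ℕ => (x ᵥ* Q ^ n) j) atTop (nhds c) := by
  obtain ⟨p, hp⟩ := Finite.exists_min fun p : ι × ι => Q p.1 p.2
  set δ := Q p.1 p.2 
  have hδ : 0 < δ := hpos _ _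
  have hδQ : ∀ i j, δ ≤ Q i j := fun i j => hp (i, j)
  set y : ℕ → ι → ℝ := fun n => x ᵥ* Q ^ n with hy
  have ysucc : ∀ n, y (n + 1) = y n ᵥ* Q := fun n => by
    simp only [hy, pow_succ, Matrix.vecMul_vecMul]
  set m : ℕ → ℝ := fun n => ⨅ i, y n i with hmdef
  set K : ℕ → ℝ := fun n => ⨆ i, y n i with hKdef
  have hm : ∀ n i, m n ≤ y n i := fun n i => ciInf_le (Set.finite_range _).bddBelow i
  have hK : ∀ n i, y n i ≤ K n := fun n i => le_ciSup (Set.finite_range _).bddAbove i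
  have step : ∀ n j, y (n + 1) j ∈
      Set.Icc (m n + δ * ∑ i, (y n i - m n)) (K n - δ * ∑ i, (K n - y n i)) := fun n j => by
    rw [ysucc]
    exact vecMul_mem_Icc_of_colStochastic Q hδQ hQ (y n) (hm n) (hK n) j
  have mstep : ∀ n, m n + δ * ∑ i, (y n i - m n) ≤ m (n + 1) := fun n =>
    le_ciInf fun j => (step n j).1
  have Kstep : ∀ n, K (n + 1) ≤ K n - δ * ∑ i, (K n - y n i) := fun n =>
    ciSup_le fun j => (step n j).2
  have mmono : Monotone m := monotone_nat_of_le_succ fun n => by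
    have := mul_nonneg hδ.le (Finset.sum_nonneg fun i (_ : i ∈ Finset.univ) =>
      sub_nonneg.2 (hm n i))
    linarith [mstep n]
  have Kanti : Antitone K := antitone_nat_of_succ_le fun n => by
    have := mul_nonneg hδ.le (Finset.sum_nonneg fun i (_ : i ∈ Finset.univ) =>
      sub_nonneg.2 (hK n i))
    linarith [Kstep n]
  have j₀ : ι := Classical.arbitrary ι
  set r : ℝ := 1 - δ * Fintype.card ι with hr
  have hr0 : 0 ≤ r := by
    have h := Finset.sum_le_sum fun i (_ : i ∈ Finset.univ) => hδQ i j₀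
    simp only [hQ, Finset.sum_const, Finset.card_univ, nsmul_eq_mul] at h
    linarith
  have hr1 : r < 1 := by
    have : (0 : ℝ) < Fintype.card ι := Nat.cast_pos.2 Fintype.card_pos
    have := mul_pos hδ this
    linarith
  have gap : ∀ n, K n - m n ≤ r ^ n * (K 0 - m 0) := fun n => by
    induction n with
    | zero => simp
    | succ n ih =>
      have hK' := Kstep n
      have hm' := mstep n
      simp only [Finset.sum_sub_distrib, Finset.sum_const, Finset.card_univ, nsmul_eq_mul]
        at hK' hm'
      calc K (n + 1) - m (n + 1) ≤ r * (K n - m n) := by rw [hr]; linarith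
        _ ≤ r * (r ^ n * (K 0 - m 0)) := mul_le_mul_of_nonneg_left ih hr0
        _ = r ^ (n + 1) * (K 0 - m 0) := by ring
  have mbdd : BddAbove (Set.range m) := ⟨K 0, by
    rintro _ ⟨n, rfl⟩
    exact ((hm n j₀).trans (hK n j₀)).trans (Kanti n.zero_le)⟩
  have mlim := tendsto_atTop_ciSup mmono mbdd
  refine ⟨⨆ n, m n, ?_, fun j => ?_⟩
  · obtain ⟨i, hi⟩ := exists_eq_ciInf_of_finite (f := y 0)
    refine lt_of_lt_of_le ?_ (le_ciSup mbdd 0)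
    have : m 0 = x i := by simp only [hmdef, ← hi]; simp [hy]
    rw [this]
    exact hx i
  · have ulim : Tendsto (fun n => m n + r ^ n * (K 0 - m 0)) atTop (nhds (⨆ n, m n)) := by
      simpa using mlim.add
        ((tendsto_pow_atTop_nhds_zero_of_lt_one hr0 hr1).mul_const (K 0 - m 0))
    exact tendsto_of_tendsto_of_tendsto_of_le_of_le mlim ulim (fun n => hm n j)
      fun n => by linarith [gap n, hK n j]

/-- Perron–Frobenius convergence: for a strictly positive matrix `M` with
strictly positive left eigenvector `β` of eigenvalue `d²`, the vectors
`d^(-2n) • ξ Mⁿ` converge to a strictly positive multiple of `β` for every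
strictly positive `ξ`. -/
theorem stmt_9 (b : ℕ) (hb : 0 < b)
    (M : Matrix (Fin b) (Fin b) ℝ) (hM : ∀ i j, 0 < M i j)
    (d : ℝ) (hd : 0 < d)
    (β : Fin b → ℝ) (hβ : ∀ j, 0 < β j)
    (heig : Matrix.vecMul β M = d ^ 2 • β)
    (ξ : Fin b → ℝ) (hξ : ∀ j, 0 < ξ j) :
    ∃ c : ℝ, 0 < c ∧ ∀ j,
      Tendsto (fun n : ℕ => d ^ (-(2 * (n : ℤ))) * (Matrix.vecMul ξ (M ^ n)) j)
        atTop (nhds (c * β j)) := by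
  have : Nonempty (Fin b) := ⟨⟨0, hb⟩⟩
  have hd2 : (0 : ℝ) < d ^ 2 := by positivity
  have hd0 := hd2.ne'
  have hβ0 : ∀ j, β j ≠ 0 := fun j => (hβ j).ne'
  obtain ⟨Q, Qdef⟩ : ∃ Q : Matrix (Fin b) (Fin b) ℝ,
      ∀ i j, Q i j = β i * M i j / (d ^ 2 * β j) :=
    ⟨Matrix.of fun i j => β i * M i j / (d ^ 2 * β j), fun _ _ => rfl⟩
  have hQ : ∀ j, ∑ i, Q i j = 1 := fun j => by
    have h := congrFun heig j
    simp only [Matrix.vecMul, dotProduct, Pi.smul_apply, smul_eq_mul] at h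
    simp only [Qdef, ← Finset.sum_div, h]
    exact div_self (mul_ne_zero hd0 (hβ0 j))
  obtain ⟨c, hc, hlim⟩ := exists_tendsto_vecMul_pow_of_colStochastic Q
    (fun i j => Qdef i j ▸ div_pos (mul_pos (hβ i) (hM i j)) (mul_pos hd2 (hβ j))) hQ
    (fun i => ξ i / β i) (fun i => div_pos (hξ i) (hβ i))
  have key : ∀ (n : ℕ) j,
      (ξ ᵥ* M ^ n) j = (d ^ 2) ^ n * (((fun i => ξ i / β i) ᵥ* Q ^ n) j * β j) := by
    intro n
    induction n with
    | zero => intro j; simp [hβ0 j]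
    | succ n ih =>
      intro j
      have expand : ∀ (v : Fin b → ℝ) (A : Matrix (Fin b) (Fin b) ℝ),
          (v ᵥ* A) j = ∑ i, v i * A i j := fun _ _ => rfl
      rw [pow_succ M, pow_succ Q, ← Matrix.vecMul_vecMul, ← Matrix.vecMul_vecMul,
        expand _ M, expand _ Q]
      simp only [ih, Finset.sum_mul, Finset.mul_sum, Qdef]
      refine Finset.sum_congr rfl fun i _ => ?_
      have := hβ0 j
      field_simp
      ring
  refine ⟨c, hc, fun j => ((hlim j).mul_const (β j)).congr fun n => ?_⟩
  rw [key, _root_.zpow_neg, _root_.zpow_mul, zpow_natCast, zpow_ofNat,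
    inv_mul_cancel_left₀ (pow_ne_zero n hd0)]
end

section
/- Let a and b be positive integers, let D : Matrix (Fin a) (Fin b) ℝ have nonnegative entries, let d > 0, and let α : Fin a → ℝ and β : Fin b → ℝ have strictly positive entries with ∑ h, α h * D h j = d * β j for all j. Define σ i j := d * β j / α i. Let δ : Fin a → Fin b → ℝ have strictly positive entries and let η : Fin a → ℝ and ξ : Fin b → ℝ have strictly positive entries with η i * δ i j = ξ j * σ i j for all i, j. Then for all i and j: δ i j * η i * (∑ h, D h j / (η h * δ h j)) = σ i j. -/
open Matrix

/-- The computation at the heart of Theorem 5.11: conjugating by a Morita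
equivalence with dimensions `η⁻¹` turns the distortion `δ` into the standard
distortion `σ i j = d * β j / α i`, provided `η i * δ i j = ξ j * σ i j`. -/
theorem stmt_12 (a b : ℕ) (ha : 0 < a) (hb : 0 < b)
    (D : Matrix (Fin a) (Fin b) ℝ) (hD : ∀ i j, 0 ≤ D i j)
    (d : ℝ) (hd : 0 < d)
    (α : Fin a → ℝ) (β : Fin b → ℝ)
    (hα : ∀ i, 0 < α i) (hβ : ∀ j, 0 < β j)
    (hFP : ∀ j, ∑ h, α h * D h j = d * β j)
    (δ : Fin a → Fin b → ℝ) (hδ : ∀ i j, 0 < δ i j)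
    (η : Fin a → ℝ) (ξ : Fin b → ℝ)
    (hη : ∀ i, 0 < η i) (hξ : ∀ j, 0 < ξ j)
    (hrel : ∀ i j, η i * δ i j = ξ j * (d * β j / α i)) :
    ∀ i j, δ i j * η i * (∑ h, D h j / (η h * δ h j)) = d * β j / α i := by
  intro i j
  have hξj := (hξ j).ne'
  have hdβ : d * β j ≠ 0 := (mul_pos hd (hβ j)).ne'
  have hsum : ∑ h, D h j / (η h * δ h j) = (ξ j)⁻¹ := by
    calc ∑ h, D h j / (η h * δ h j) = ∑ h, α h * D h j / (ξ j * (d * β j)) := by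
          refine Finset.sum_congr rfl fun h _ => ?_
          rw [hrel, ← mul_div_assoc, div_div_eq_mul_div, mul_comm (D h j)]
      _ = d * β j / (ξ j * (d * β j)) := by rw [← Finset.sum_div, hFP]
      _ = (ξ j)⁻¹ := by rw [div_mul_cancel_right₀ hdβ]
  rw [hsum, mul_comm (δ i j), hrel, mul_comm (ξ j), mul_inv_cancel_right₀ hξj]
end

section
/- Let a and b be positive integers, let D : Matrix (Fin a) (Fin b) ℝ have nonnegative entries with every column of D nonzero, and let α : Fin a → ℝ have strictly positive entries. For ρ : Fin a → ℝ with strictly positive entries define δ^ρ i j := (α i)⁻¹ * (ρ i)⁻¹ * ∑ h, ρ h * D h j * α h. If ρ and ρ' both have strictly positive entries and δ^ρ i j = δ^{ρ'} i j for all i, j, then there exists a real c > 0 with ρ' = c • ρ. -/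
open Matrix

/-- Proposition 5.10 injectivity: the realizable distortion `δ^ρ` determines
the Morita-equivalence dimension vector `ρ` up to a positive scalar. -/
theorem stmt_13 (a b : ℕ) (ha : 0 < a) (hb : 0 < b)
    (D : Matrix (Fin a) (Fin b) ℝ) (hD : ∀ i j, 0 ≤ D i j)
    (hcol : ∀ j, (fun i => D i j) ≠ 0)
    (α : Fin a → ℝ) (hα : ∀ i, 0 < α i)
    (ρ ρ' : Fin a → ℝ) (hρ : ∀ i, 0 < ρ i) (hρ' : ∀ i, 0 < ρ' i)
    (heq : ∀ i j,
      (α i)⁻¹ * (ρ i)⁻¹ * ∑ h, ρ h * D h j * α h =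
      (α i)⁻¹ * (ρ' i)⁻¹ * ∑ h, ρ' h * D h j * α h) :
    ∃ c : ℝ, 0 < c ∧ ρ' = c • ρ := by
  have sum_pos (σ : Fin a → ℝ) (hσ : ∀ i, 0 < σ i) (j : Fin b) :
      0 < ∑ h, σ h * D h j * α h := by
    obtain ⟨k, hk⟩ := Function.ne_iff.mp (hcol j)
    have hk' : 0 < D k j := lt_of_le_of_ne (hD k j) (Ne.symm hk)
    exact Finset.sum_pos'
      (fun h _ => mul_nonneg (mul_nonneg (hσ h).le (hD h j)) (hα h).le)
      ⟨k, Finset.mem_univ k, mul_pos (mul_pos (hσ k) hk') (hα k)⟩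
  have hS := sum_pos ρ hρ ⟨0, hb⟩
  have hS' := sum_pos ρ' hρ' ⟨0, hb⟩
  refine ⟨_, div_pos hS' hS, funext fun i => ?_⟩
  have h := heq i ⟨0, hb⟩
  have hαi := (hα i).ne'
  have hρi := (hρ i).ne'
  have hρi' := (hρ' i).ne'
  rw [Pi.smul_apply, smul_eq_mul]
  generalize ∑ h, ρ h * D h ⟨0, hb⟩ * α h = S at *
  generalize ∑ h, ρ' h * D h ⟨0, hb⟩ * α h = S' at *
  field_simp at h ⊢
  linarith
end

section
/- Let k and m be positive integers, let Λ : Matrix (Fin k) (Fin m) ℝ have nonnegative entries, let d > 0, and let v : Fin k → ℝ have strictly positive entries with (Λ * Λᵀ).mulVec v = d^2 • v. Then for every w : Fin k → ℝ with strictly positive entries: (i) for every natural number n, the vector ((Λ * Λᵀ) ^ n).mulVec w has strictly positive entries; and (ii) there exists u : Fin k → ℝ with strictly positive entries such that for every i, the sequence n ↦ d^(-(2*n)) * ((((Λ * Λᵀ) ^ n).mulVec w) i) converges (as n → ∞) to u i. -/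
open Matrix Filter

section PerronFrobenius

variable {ι : Type*} [Fintype ι] {A : Matrix ι ι ℝ}

/-- A positive eigenvector of a nonnegative matrix belongs to the spectral radius. -/
lemma abs_le_of_mulVec_eq_smul_of_pos (hA : ∀ i j, 0 ≤ A i j) {v x : ι → ℝ} {r μ : ℝ}
    (hv : ∀ i, 0 < v i) (hvr : A *ᵥ v = r • v) (hx : x ≠ 0) (hxμ : A *ᵥ x = μ • x) :
    |μ| ≤ r := by
  obtain ⟨j₀, hj₀⟩ := Function.ne_iff.mp hx
  have : Nonempty ι := ⟨j₀⟩
  obtain ⟨i, hi⟩ := Finite.exists_max fun j => |x j| / v j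
  have hpos : 0 < |x i| / v i := (div_pos (abs_pos.mpr hj₀) (hv j₀)).trans_le (hi j₀)
  have hle (j : ι) : |x j| ≤ |x i| / v i * v j := (div_le_iff₀ (hv j)).mp (hi j)
  have hxi : 0 < |x i| := (div_pos_iff_of_pos_right (hv i)).mp hpos
  refine le_of_mul_le_mul_right ?_ hxi
  calc |μ| * |x i| = |∑ j, A i j * x j| := by
        rw [← abs_mul]; exact congrArg abs (congrFun hxμ i).symm
    _ ≤ ∑ j, |A i j * x j| := Finset.abs_sum_le_sum_abs _ _
    _ ≤ ∑ j, A i j * (|x i| / v i * v j) := Finset.sum_le_sum fun j _ => by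
        rw [abs_mul, abs_of_nonneg (hA i j)]
        exact mul_le_mul_of_nonneg_left (hle j) (hA i j)
    _ = |x i| / v i * (A *ᵥ v) i := by
        simp only [mulVec, dotProduct, Finset.mul_sum]
        exact Finset.sum_congr rfl fun j _ => by ring
    _ = r * |x i| := by
        rw [hvr, Pi.smul_apply, smul_eq_mul]
        field_simp [(hv i).ne']

lemma exists_pos_smul_le_s16 [Nonempty ι] {v w : ι → ℝ} (hv : ∀ i, 0 < v i) (hw : ∀ i, 0 < w i) :
    ∃ c : ℝ, 0 < c ∧ ∀ i, c * v i ≤ w i := by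
  obtain ⟨i, hi⟩ := Finite.exists_min fun j => w j / v j
  exact ⟨w i / v i, div_pos (hw i) (hv i), fun j => (le_div_iff₀ (hv j)).mp (hi j)⟩

variable [DecidableEq ι]

lemma pow_mulVec_of_mulVec_eq_smul {x : ι → ℝ} {μ : ℝ} (h : A *ᵥ x = μ • x) (n : ℕ) :
    (A ^ n) *ᵥ x = μ ^ n • x := by
  induction n with
  | zero => simp
  | succ n ih => rw [pow_succ, ← mulVec_mulVec, h, mulVec_smul, ih, smul_smul, pow_succ']

lemma pow_mulVec_nonneg (hA : ∀ i j, 0 ≤ A i j) {x : ι → ℝ} (hx : ∀ i, 0 ≤ x i) (n : ℕ) (i : ι) :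
    0 ≤ ((A ^ n) *ᵥ x) i := by
  induction n generalizing i with
  | zero => simpa using hx i
  | succ n ih =>
    rw [pow_succ', ← mulVec_mulVec]
    exact Finset.sum_nonneg fun j _ => mul_nonneg (hA i j) (ih j)

/-- The normalized powers of a positive semidefinite matrix with spectral radius at most `r`
converge pointwise. -/
lemma Matrix.PosSemidef.exists_tendsto_pow_mulVec (hA : A.PosSemidef) {r : ℝ} (hr : 0 < r)
    (hle : ∀ j, hA.isHermitian.eigenvalues j ≤ r) (w : ι → ℝ) :
    ∃ u : ι → ℝ, ∀ i, Tendsto (fun n : ℕ => (r ^ n)⁻¹ * ((A ^ n) *ᵥ w) i) atTop (nhds (u i)) := by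
  set b := hA.isHermitian.eigenvectorBasis
  set ev := hA.isHermitian.eigenvalues
  set c : ι → ℝ := fun j => b.repr (WithLp.toLp 2 w) j
  have hw : w = ∑ j, c j • (b j).ofLp := by
    have := congrArg WithLp.ofLp (b.sum_repr (WithLp.toLp 2 w))
    simpa [c] using this.symm
  have hpow (n : ℕ) (i : ι) :
      (r ^ n)⁻¹ * ((A ^ n) *ᵥ w) i = ∑ j, (ev j / r) ^ n * (c j * (b j).ofLp i) := by
    have hb (j : ι) : (A ^ n) *ᵥ (b j).ofLp = ev j ^ n • (b j).ofLp :=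
      pow_mulVec_of_mulVec_eq_smul (hA.isHermitian.mulVec_eigenvectorBasis j) n
    conv_lhs => rw [hw]
    simp only [mulVec_sum, mulVec_smul, hb, Finset.sum_apply, Pi.smul_apply, smul_eq_mul,
      Finset.mul_sum, div_pow]
    exact Finset.sum_congr rfl fun j _ => by ring
  have hlim (j : ι) : ∃ l : ℝ, Tendsto (fun n : ℕ => (ev j / r) ^ n) atTop (nhds l) := by
    rcases (hle j).eq_or_lt with h | h
    · exact ⟨1, by simp [h, hr.ne']⟩
    · exact ⟨0, tendsto_pow_atTop_nhds_zero_of_lt_one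
        (div_nonneg (hA.eigenvalues_nonneg j) hr.le) ((div_lt_one hr).mpr h)⟩
  choose l hl using hlim
  refine ⟨fun i => ∑ j, l j * (c j * (b j).ofLp i), fun i => ?_⟩
  simp only [hpow]
  exact tendsto_finsetSum _ fun j _ => (hl j).mul_const _

lemma mul_le_pow_mulVec (hA : ∀ i j, 0 ≤ A i j) {v w : ι → ℝ} {r c : ℝ}
    (hvr : A *ᵥ v = r • v) (hc : ∀ i, c * v i ≤ w i) (n : ℕ) (i : ι) :
    r ^ n * (c * v i) ≤ ((A ^ n) *ᵥ w) i := by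
  have h := pow_mulVec_nonneg hA (x := w - c • v) (fun j => by simpa using hc j) n i
  rw [mulVec_sub, mulVec_smul, pow_mulVec_of_mulVec_eq_smul hvr] at h
  simp only [Pi.sub_apply, Pi.smul_apply, smul_eq_mul] at h
  linarith

end PerronFrobenius

/-- Proposition C.7 (matrix content): the density vectors
`d^(-2n) • (ΛΛᵀ)ⁿ w` are strictly positive and converge to a strictly positive
limit, where `v` is a strictly positive eigenvector of `ΛΛᵀ` with eigenvalue `d²`. -/
theorem stmt_16 (k m : ℕ) (hk : 0 < k) (hm : 0 < m)
    (Λ : Matrix (Fin k) (Fin m) ℝ) (hΛ : ∀ i j, 0 ≤ Λ i j)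
    (d : ℝ) (hd : 0 < d)
    (v : Fin k → ℝ) (hv : ∀ i, 0 < v i)
    (heig : (Λ * Λᵀ).mulVec v = d ^ 2 • v)
    (w : Fin k → ℝ) (hw : ∀ i, 0 < w i) :
    (∀ n : ℕ, ∀ i, 0 < (((Λ * Λᵀ) ^ n).mulVec w) i) ∧
    ∃ u : Fin k → ℝ, (∀ i, 0 < u i) ∧ ∀ i,
      Tendsto (fun n : ℕ => d ^ (-(2 * (n : ℤ))) * (((Λ * Λᵀ) ^ n).mulVec w) i)
        atTop (nhds (u i)) := by
  have : Nonempty (Fin k) := ⟨⟨0, hk⟩⟩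
  have hA (i j : Fin k) : 0 ≤ (Λ * Λᵀ) i j :=
    mul_apply (M := Λ) ▸ Finset.sum_nonneg fun l _ => mul_nonneg (hΛ i l) (hΛ j l)
  have hpsd : (Λ * Λᵀ).PosSemidef := by
    simpa only [conjTranspose_eq_transpose_of_trivial] using posSemidef_self_mul_conjTranspose Λ
  have hr : 0 < d ^ 2 := by positivity
  obtain ⟨c, hc, hcw⟩ := exists_pos_smul_le_s16 hv hw
  have hlower := mul_le_pow_mulVec hA heig hcw
  refine ⟨fun n i => (mul_pos (pow_pos hr n) (mul_pos hc (hv i))).trans_le (hlower n i), ?_⟩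
  have hle (j : Fin k) : hpsd.isHermitian.eigenvalues j ≤ d ^ 2 := by
    refine (le_abs_self _).trans (abs_le_of_mulVec_eq_smul_of_pos hA hv heig ?_
      (hpsd.isHermitian.mulVec_eigenvectorBasis j))
    intro h
    exact hpsd.isHermitian.eigenvectorBasis.orthonormal.ne_zero j (PiLp.ext (congrFun h))
  obtain ⟨u, hu⟩ := hpsd.exists_tendsto_pow_mulVec hr hle w
  refine ⟨u, fun i => (mul_pos hc (hv i)).trans_le (ge_of_tendsto' (hu i) fun n => ?_),
    fun i => ?_⟩
  · rw [inv_mul_eq_div, le_div_iff₀ (pow_pos hr n), mul_comm]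
    exact hlower n i
  · refine (hu i).congr fun n => ?_
    rw [_root_.zpow_neg, ← pow_mul]
    norm_cast
end
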